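/- Let k be an odd integer and x ∈ ℝ, and set z = (x+i)²/(x²+1) ∈ ℂ (so |z| = 1 and z ≠ 1). Then (1/π)·PV∫ u_k'(y)/(x−y) dy = −2i/(π(k+2)) − k·(x+i)^k/(x²+1)^{k/2+1} + (8i/(π(4−k²)))·∑_{n=0}^∞ [(1)_n·(−k/2−1)_n/((−k/2+2)_n · n!)]·z^n, i.e. the principal value equals −2i/(π(k+2)) − k(x+i)^k/(x²+1)^{k/2+1} + (8i/(π(4−k²)))·₂F₁(1, −k/2−1; −k/2+2; z). -/

import Mathlib

open Filter MeasureTheory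

/-- `u_k(y) = (y+i)^k/(y²+1)^{k/2}`, with `(y+i)^k` a `zpow` in `ℂ` and `(y²+1)^{k/2}` a real
power. -/
noncomputable def uFun (k : ℤ) (y : ℝ) : ℂ :=
  ((y : ℂ) + Complex.I) ^ k / ((((y ^ 2 + 1 : ℝ) ^ ((k : ℝ) / 2) : ℝ)) : ℂ)

open Complex in
/-- `u_k` in exponential form, with `π/2 - arctan y` the argument of `y + i`. -/
theorem uFun_eq_exp (k : ℤ) (y : ℝ) :
    uFun k y = exp (k * (((Real.pi / 2 - Real.arctan y : ℝ) : ℂ) * I)) := by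
  have hs : 0 < √(1 + y ^ 2) := Real.sqrt_pos.2 (by positivity)
  have hbase : exp (((Real.pi / 2 - Real.arctan y : ℝ) : ℂ) * I)
      = ((y : ℂ) + I) / (√(1 + y ^ 2) : ℝ) := by
    rw [exp_mul_I, ← ofReal_cos, ← ofReal_sin, Real.cos_pi_div_two_sub, Real.sin_pi_div_two_sub,
      Real.cos_arctan, Real.sin_arctan]
    push_cast
    ring
  have hpow : (y ^ 2 + 1 : ℝ) ^ ((k : ℝ) / 2) = √(1 + y ^ 2) ^ k := by
    rw [← Real.rpow_intCast, Real.sqrt_eq_rpow, ← Real.rpow_mul (by positivity), add_comm (y ^ 2)]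
    congr 1
    ring
  rw [exp_int_mul, hbase, uFun, hpow, div_zpow, ofReal_zpow]

theorem uFun_add (j k : ℤ) (y : ℝ) : uFun (j + k) y = uFun j y * uFun k y := by
  simp only [uFun_eq_exp, ← Complex.exp_add, Int.cast_add, add_mul]

theorem norm_uFun (k : ℤ) (y : ℝ) : ‖uFun k y‖ = 1 := by
  rw [uFun_eq_exp, ← mul_assoc, ← Complex.ofReal_intCast, ← Complex.ofReal_mul,
    Complex.norm_exp_ofReal_mul_I]

theorem uFun_zero (y : ℝ) : uFun 0 y = 1 := by
  simp [uFun]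

theorem ofReal_add_I_ne_zero (y : ℝ) : (y : ℂ) + Complex.I ≠ 0 := fun h => by
  simpa using congrArg Complex.im h

theorem ofReal_sub_I_ne_zero (y : ℝ) : (y : ℂ) - Complex.I ≠ 0 := fun h => by
  simpa using congrArg Complex.im h

theorem add_I_mul_sub_I (y : ℝ) :
    ((y : ℂ) + Complex.I) * ((y : ℂ) - Complex.I) = 1 + (y : ℂ) ^ 2 := by
  linear_combination -Complex.I_sq

theorem one_add_ofReal_sq_ne_zero (y : ℝ) : 1 + (y : ℂ) ^ 2 ≠ 0 := by
  rw [← add_I_mul_sub_I]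
  exact mul_ne_zero (ofReal_add_I_ne_zero y) (ofReal_sub_I_ne_zero y)

theorem sqrt_one_add_sq_ne_zero (y : ℝ) : ((√(1 + y ^ 2) : ℝ) : ℂ) ≠ 0 :=
  Complex.ofReal_ne_zero.2 (Real.sqrt_pos.2 (by positivity)).ne'

theorem ofReal_sqrt_one_add_sq_sq (y : ℝ) :
    ((√(1 + y ^ 2) : ℝ) : ℂ) ^ 2 = 1 + (y : ℂ) ^ 2 := by
  rw [← Complex.ofReal_pow, Real.sq_sqrt (by positivity)]
  push_cast
  rfl

theorem uFun_one (y : ℝ) : uFun 1 y = ((y : ℂ) + Complex.I) / (√(1 + y ^ 2) : ℝ) := by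
  simp [uFun, Real.sqrt_eq_rpow, add_comm]

theorem uFun_two (y : ℝ) : uFun 2 y = ((y : ℂ) + Complex.I) / ((y : ℂ) - Complex.I) := by
  rw [show (2 : ℤ) = 1 + 1 from rfl, uFun_add, uFun_one, div_mul_div_comm, ← sq, ← sq,
    ofReal_sqrt_one_add_sq_sq, ← add_I_mul_sub_I, sq,
    mul_div_mul_left _ _ (ofReal_add_I_ne_zero y)]

theorem uFun_neg_one (y : ℝ) :
    uFun (-1) y = ((√(1 + y ^ 2) : ℝ) : ℂ) / ((y : ℂ) + Complex.I) := by
  have h := uFun_add (-1) 1 y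
  rw [neg_add_cancel, uFun_zero, uFun_one] at h
  have := ofReal_add_I_ne_zero y
  have := sqrt_one_add_sq_ne_zero y
  field_simp at h ⊢
  exact h.symm

theorem uFun_one_sub_uFun_neg_one (y : ℝ) :
    uFun 1 y - uFun (-1) y = 2 * Complex.I / (√(1 + y ^ 2) : ℝ) := by
  have h1 := ofReal_add_I_ne_zero y
  have h2 := sqrt_one_add_sq_ne_zero y
  rw [uFun_one, uFun_neg_one, div_sub_div _ _ h2 h1, div_eq_div_iff (mul_ne_zero h2 h1) h2, ← sq,
    ← sq, ofReal_sqrt_one_add_sq_sq]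
  linear_combination ((√(1 + y ^ 2) : ℝ) : ℂ) * -Complex.I_sq

theorem uFun_add_two_sub (k : ℤ) (x y : ℝ) :
    uFun (k + 2) y - uFun 2 x * uFun k y
      = 2 * Complex.I * (x - y) / ((y - Complex.I) * (x - Complex.I)) * uFun k y := by
  have h1 := ofReal_sub_I_ne_zero y
  have h2 := ofReal_sub_I_ne_zero x
  rw [uFun_add, uFun_two, uFun_two]
  field_simp
  ring

theorem hasDerivAt_uFun (k : ℤ) (y : ℝ) :
    HasDerivAt (uFun k) (-(Complex.I * k * uFun k y / (1 + (y : ℂ) ^ 2))) y := by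
  have h := (((Real.hasDerivAt_arctan y).const_sub (Real.pi / 2)).ofReal_comp.mul_const
    Complex.I).const_mul (k : ℂ) |>.cexp
  rw [← funext (uFun_eq_exp k), ← uFun_eq_exp] at h
  convert h using 1
  push_cast
  ring

theorem continuous_uFun (k : ℤ) : Continuous (uFun k) :=
  continuous_iff_continuousAt.2 fun y => (hasDerivAt_uFun k y).continuousAt

theorem tendsto_uFun_of_tendsto_arctan {l : Filter ℝ} {a : ℝ}
    (h : Tendsto Real.arctan l (nhds a)) (k : ℤ) :
    Tendsto (uFun k) l
      (nhds (Complex.exp (k * (((Real.pi / 2 - a : ℝ) : ℂ) * Complex.I)))) := by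
  rw [funext (uFun_eq_exp k)]
  exact (Complex.continuous_exp.tendsto _).comp
    (tendsto_const_nhds.mul ((Complex.continuous_ofReal.tendsto _).comp
      (tendsto_const_nhds.sub h) |>.mul tendsto_const_nhds))

theorem tendsto_uFun_atTop (k : ℤ) : Tendsto (uFun k) atTop (nhds 1) := by
  simpa using tendsto_uFun_of_tendsto_arctan
    (Real.tendsto_arctan_atTop.mono_right nhdsWithin_le_nhds) k

theorem tendsto_uFun_atBot (k : ℤ) : Tendsto (uFun k) atBot (nhds ((-1) ^ k)) := by
  have h := tendsto_uFun_of_tendsto_arctan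
    (Real.tendsto_arctan_atBot.mono_right nhdsWithin_le_nhds) k
  rwa [sub_neg_eq_add, add_halves, Complex.exp_int_mul, Complex.exp_pi_mul_I] at h

theorem integrable_ofReal_inv_one_add_sq : Integrable fun y : ℝ => (1 + (y : ℂ) ^ 2)⁻¹ := by
  simpa using integrable_inv_one_add_sq.ofReal (𝕜 := ℂ)

theorem integrable_uFun_div (k : ℤ) : Integrable fun y : ℝ => uFun k y / (1 + (y : ℂ) ^ 2) :=
  integrable_ofReal_inv_one_add_sq.bdd_mul (c := 1) (continuous_uFun k).aestronglyMeasurable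
    (.of_forall fun y => (norm_uFun k y).le)

theorem integral_uFun_div {k : ℤ} (hk : k ≠ 0) :
    ∫ y : ℝ, uFun k y / (1 + (y : ℂ) ^ 2) = Complex.I / k * (1 - (-1) ^ k) := by
  have hk' : (k : ℂ) ≠ 0 := Int.cast_ne_zero.2 hk
  rw [integral_of_hasDerivAt_of_tendsto (f := fun y => Complex.I / k * uFun k y) (fun y => ?_)
    (integrable_uFun_div k) ((tendsto_uFun_atBot k).const_mul _)
    ((tendsto_uFun_atTop k).const_mul _)]
  · ring
  · refine ((hasDerivAt_uFun k y).const_mul (Complex.I / k)).congr_deriv ?_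
    have := one_add_ofReal_sq_ne_zero y
    field_simp
    linear_combination -uFun k y * Complex.I_sq

/-- A function on `ℝ` that is integrable away from `x` has principal value `L` at `x`. -/
def HasPV (x : ℝ) (f : ℝ → ℂ) (L : ℂ) : Prop :=
  (∀ ε > 0, IntegrableOn f {y : ℝ | ε ≤ |x - y|}) ∧
    Tendsto (fun ε : ℝ => ∫ y in {y : ℝ | ε ≤ |x - y|}, f y) (nhdsWithin 0 (Set.Ioi 0)) (nhds L)

theorem measurableSet_le_abs_sub (x ε : ℝ) : MeasurableSet {y : ℝ | ε ≤ |x - y|} :=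
  measurableSet_le measurable_const (measurable_const.sub measurable_id).abs

namespace HasPV

variable {x : ℝ} {f g : ℝ → ℂ} {L M : ℂ}

theorem of_integrable (x : ℝ) (hf : Integrable f) : HasPV x f (∫ y, f y) := by
  refine ⟨fun ε _ => hf.integrableOn, ?_⟩
  simp only [← integral_indicator (measurableSet_le_abs_sub x _)]
  refine tendsto_integral_filter_of_dominated_convergence (fun y => ‖f y‖)
    (.of_forall fun ε => hf.1.indicator (measurableSet_le_abs_sub x ε))
    (.of_forall fun ε => .of_forall fun y => norm_indicator_le_norm_self _ _) hf.norm ?_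
  filter_upwards [Measure.ae_ne volume x] with y hy
  refine tendsto_const_nhds.congr' ?_
  filter_upwards [nhdsWithin_le_nhds (eventually_le_nhds (abs_pos.2 (sub_ne_zero.2 hy.symm)))]
    with ε hε
  exact (Set.indicator_of_mem (s := {y : ℝ | ε ≤ |x - y|}) hε f).symm

theorem add (hf : HasPV x f L) (hg : HasPV x g M) : HasPV x (fun y => f y + g y) (L + M) := by
  refine ⟨fun ε hε => (hf.1 ε hε).add (hg.1 ε hε), (hf.2.add hg.2).congr' ?_⟩
  filter_upwards [self_mem_nhdsWithin] with ε hε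
  exact (integral_add (hf.1 ε hε) (hg.1 ε hε)).symm

theorem const_mul (c : ℂ) (hf : HasPV x f L) : HasPV x (fun y => c * f y) (c * L) :=
  ⟨fun ε hε => (hf.1 ε hε).const_mul c,
    (hf.2.const_mul c).congr fun _ => (integral_const_mul c _).symm⟩

theorem congr (hf : HasPV x f L) (h : ∀ y, y ≠ x → f y = g y) : HasPV x g L := by
  have key : ∀ ε > 0, Set.EqOn f g {y : ℝ | ε ≤ |x - y|} := fun ε hε y hy => h y fun hxy => by
    rw [Set.mem_ofPred_eq, hxy, sub_self, abs_zero] at hy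
    exact hy.not_gt hε
  refine ⟨fun ε hε => (hf.1 ε hε).congr_fun (key ε hε) (measurableSet_le_abs_sub x ε),
    hf.2.congr' ?_⟩
  filter_upwards [self_mem_nhdsWithin] with ε hε
  exact setIntegral_congr_fun (measurableSet_le_abs_sub x ε) (key ε hε)

theorem unique (hf : HasPV x f L) (hg : HasPV x f M) : L = M :=
  tendsto_nhds_unique hf.2 hg.2

end HasPV

theorem integrableOn_inv_add_I_mul_sub (x : ℝ) {ε : ℝ} (hε : 0 < ε) :
    IntegrableOn (fun y : ℝ => 1 / (((y : ℂ) + Complex.I) * (x - y))) {y : ℝ | ε ≤ |x - y|} := by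
  set C : ℝ := (1 + |x|) / ε + 1
  refine Integrable.mono' ((integrable_inv_one_add_sq.const_mul C).integrableOn)
    (Measurable.aestronglyMeasurable (by fun_prop)) ?_
  refine (ae_restrict_iff' (measurableSet_le_abs_sub x ε)).2 (.of_forall fun y hy => ?_)
  have hy : ε ≤ |x - y| := hy
  have hd : 0 < |x - y| := hε.trans_le hy
  have hs : 0 < √(1 + y ^ 2) := Real.sqrt_pos.2 (by positivity)
  have hsC : √(1 + y ^ 2) ≤ C * |x - y| := by
    have h1 : √(1 + y ^ 2) ≤ 1 + |y| := by
      rw [Real.sqrt_le_left (by positivity), ← sq_abs y]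
      nlinarith [abs_nonneg y]
    have h2 : |y| ≤ |x| + |x - y| := by
      simpa using abs_sub x (x - y)
    have h3 : 1 + |x| ≤ (1 + |x|) / ε * |x - y| := by
      rw [div_mul_eq_mul_div, le_div_iff₀ hε]
      exact mul_le_mul_of_nonneg_left hy (by positivity)
    linarith [add_mul ((1 + |x|) / ε) 1 |x - y|]
  have hn1 : ‖(y : ℂ) + Complex.I‖ = √(1 + y ^ 2) := by
    simpa [add_comm] using Complex.norm_add_mul_I y 1
  have hn2 : ‖(x : ℂ) - y‖ = |x - y| := by
    rw [← Complex.ofReal_sub, Complex.norm_real, Real.norm_eq_abs]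
  rw [norm_div, norm_mul, norm_one, hn1, hn2, ← div_eq_mul_inv,
    div_le_div_iff₀ (by positivity) (by positivity)]
  nlinarith [Real.sq_sqrt (show 0 ≤ 1 + y ^ 2 by positivity)]

theorem tendsto_log_sub_log {l : Filter ℝ} (x : ℝ)
    (hl : Tendsto (fun y : ℝ => y⁻¹) l (nhds 0)) (hne : ∀ᶠ y in l, y ≠ 0) (hx : ∀ᶠ y in l, y ≠ x) :
    Tendsto (fun y : ℝ => Real.log (1 + y ^ 2) / 2 - Real.log (x - y)) l (nhds 0) := by
  have h : Tendsto (fun y : ℝ => Real.log ((y⁻¹ ^ 2 + 1) / (x * y⁻¹ - 1) ^ 2) / 2) l (nhds 0) := by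
    have : Tendsto (fun y : ℝ => (y⁻¹ ^ 2 + 1) / (x * y⁻¹ - 1) ^ 2) l (nhds 1) := by
      simpa [Pi.div_def] using
        ((hl.pow 2).add_const 1).div (((hl.const_mul x).sub_const 1).pow 2) (by simp)
    simpa using ((Real.continuousAt_log one_ne_zero).tendsto.comp this).div_const 2
  refine h.congr' ?_
  filter_upwards [hne, hx] with y hy hxy
  have hxy' : x - y ≠ 0 := sub_ne_zero.2 hxy.symm
  have : (y⁻¹ ^ 2 + 1) / (x * y⁻¹ - 1) ^ 2 = (1 + y ^ 2) / (x - y) ^ 2 := by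
    have : x * y⁻¹ - 1 ≠ 0 := by
      field_simp
      exact div_ne_zero hxy' hy
    field_simp
  rw [this, Real.log_div (by positivity) (by positivity), Real.log_pow]
  push_cast
  ring

theorem hasPV_inv_add_I_mul_sub (x : ℝ) :
    HasPV x (fun y => 1 / (((y : ℂ) + Complex.I) * (x - y)))
      (-(Complex.I * Real.pi) / (x + Complex.I)) := by
  refine ⟨fun ε hε => integrableOn_inv_add_I_mul_sub x hε, ?_⟩
  set F : ℝ → ℂ := fun y => (((Real.log (1 + y ^ 2) / 2 - Real.log (x - y) : ℝ) : ℂ)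
    - Complex.I * (Real.arctan y : ℝ)) / (x + Complex.I) with hF
  have hderiv : ∀ y ≠ x, HasDerivAt F (1 / (((y : ℂ) + Complex.I) * (x - y))) y := by
    intro y hy
    have hxy : x - y ≠ 0 := sub_ne_zero.2 hy.symm
    have h1 : HasDerivAt (fun y : ℝ => Real.log (1 + y ^ 2) / 2 - Real.log (x - y))
        (y / (1 + y ^ 2) + 1 / (x - y)) y := by
      have := ((((hasDerivAt_pow 2 y).const_add 1).log (by positivity)).div_const 2).sub
        (((hasDerivAt_id y).const_sub x).log hxy)
      refine this.congr_deriv ?_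
      have : 1 + y ^ 2 ≠ 0 := by positivity
      simp only [id]
      field_simp
      ring
    refine ((h1.ofReal_comp.sub ((Real.hasDerivAt_arctan y).ofReal_comp.const_mul
      Complex.I)).div_const (x + Complex.I)).congr_deriv ?_
    have h2 := ofReal_add_I_ne_zero x
    have h3 := ofReal_add_I_ne_zero y
    have h4 := ofReal_sub_I_ne_zero y
    have h5 : (x : ℂ) - y ≠ 0 := by exact_mod_cast hxy
    push_cast
    rw [← add_I_mul_sub_I]
    field_simp
    ring
  have htop : Tendsto F atTop
      (nhds (((0 : ℝ) - Complex.I * (Real.pi / 2 : ℝ)) / (x + Complex.I))) := by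
    refine Tendsto.div_const (.sub ?_ (.const_mul _ ?_)) _
    · exact (Complex.continuous_ofReal.tendsto _).comp
        (tendsto_log_sub_log x tendsto_inv_atTop_zero (eventually_ne_atTop 0)
          (eventually_ne_atTop x))
    · exact (Complex.continuous_ofReal.tendsto _).comp
        (Real.tendsto_arctan_atTop.mono_right nhdsWithin_le_nhds)
  have hbot : Tendsto F atBot
      (nhds (((0 : ℝ) - Complex.I * (-(Real.pi / 2) : ℝ)) / (x + Complex.I))) := by
    refine Tendsto.div_const (.sub ?_ (.const_mul _ ?_)) _
    · exact (Complex.continuous_ofReal.tendsto _).comp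
        (tendsto_log_sub_log x tendsto_inv_atBot_zero (eventually_ne_atBot 0)
          (eventually_ne_atBot x))
    · exact (Complex.continuous_ofReal.tendsto _).comp
        (Real.tendsto_arctan_atBot.mono_right nhdsWithin_le_nhds)
  have hint : ∀ ε > 0, ∫ y in {y : ℝ | ε ≤ |x - y|}, 1 / (((y : ℂ) + Complex.I) * (x - y))
      = F (x - ε) - F (x + ε) - Complex.I * Real.pi / (x + Complex.I) := by
    intro ε hε
    have hset : {y : ℝ | ε ≤ |x - y|} = Set.Iic (x - ε) ∪ Set.Ici (x + ε) := by
      ext y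
      simp only [Set.mem_ofPred_eq, Set.mem_union, Set.mem_Iic, Set.mem_Ici, le_abs]
      constructor <;> rintro (h | h)
      · exact .inl (by linarith)
      · exact .inr (by linarith)
      · exact .inl (by linarith)
      · exact .inr (by linarith)
    have hI := integrableOn_inv_add_I_mul_sub x hε
    rw [hset] at hI ⊢
    have hI1 := hI.mono_set Set.subset_union_left
    have hI2 := hI.mono_set Set.subset_union_right
    rw [setIntegral_union (Set.disjoint_left.2 fun y h1 h2 => by
        simp only [Set.mem_Iic, Set.mem_Ici] at h1 h2; linarith) measurableSet_Ici hI1 hI2,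
      integral_Iic_of_hasDerivAt_of_tendsto' (fun y hy => hderiv y ?_) hI1 hbot,
      integral_Ici_eq_integral_Ioi,
      integral_Ioi_of_hasDerivAt_of_tendsto' (fun y hy => hderiv y ?_)
        (hI2.mono_set Set.Ioi_subset_Ici_self) htop]
    · push_cast
      ring
    · rw [Set.mem_Ici] at hy
      linarith
    · rw [Set.mem_Iic] at hy
      linarith
  set G : ℝ → ℂ := fun ε => (((Real.log (1 + (x - ε) ^ 2) - Real.log (1 + (x + ε) ^ 2)) / 2 : ℝ)
    - Complex.I * (Real.arctan (x - ε) - Real.arctan (x + ε) : ℝ)) / (x + Complex.I)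
    - Complex.I * Real.pi / (x + Complex.I) with hG
  have hGc : Continuous G := by
    have h1 : Continuous fun ε : ℝ =>
        (Real.log (1 + (x - ε) ^ 2) - Real.log (1 + (x + ε) ^ 2)) / 2 :=
      (((by fun_prop : Continuous fun ε : ℝ => 1 + (x - ε) ^ 2).log fun _ => by positivity).sub
        ((by fun_prop : Continuous fun ε : ℝ => 1 + (x + ε) ^ 2).log
          fun _ => by positivity)).div_const 2
    have h2 : Continuous fun ε : ℝ => Real.arctan (x - ε) - Real.arctan (x + ε) := by fun_prop
    exact (((Complex.continuous_ofReal.comp h1).sub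
      (continuous_const.mul (Complex.continuous_ofReal.comp h2))).div_const _).sub
      continuous_const
  have hG0 : G 0 = -(Complex.I * Real.pi) / (x + Complex.I) := by
    simp [hG, neg_div]
  rw [← hG0]
  refine ((hGc.tendsto 0).mono_left nhdsWithin_le_nhds).congr' ?_
  filter_upwards [self_mem_nhdsWithin] with ε hε
  rw [hint ε hε, hG, hF]
  simp only [sub_sub_cancel, sub_add_cancel_left, Real.log_neg_eq_log]
  push_cast
  ring

theorem sub_I_inv (y : ℝ) : ((y : ℂ) - Complex.I)⁻¹ = (uFun 2 y - 1) / (2 * Complex.I) := by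
  have h := ofReal_sub_I_ne_zero y
  have hI := Complex.I_ne_zero
  rw [uFun_two]
  field_simp
  ring

theorem uFun_div_sub_succ (k : ℤ) {x y : ℝ} (hy : y ≠ x) (w : ℂ) :
    uFun (k + 2) y / (w * (x - y)) = uFun 2 x * (uFun k y / (w * (x - y)))
      + 1 / (x - Complex.I) * (uFun (k + 2) y / w - uFun k y / w) := by
  have h1 := uFun_add_two_sub k x y
  have h2 := sub_I_inv y
  have h3 : (x : ℂ) - y ≠ 0 := by exact_mod_cast sub_ne_zero.2 hy.symm
  have h4 := ofReal_sub_I_ne_zero x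
  rw [mul_comm ((y : ℂ) - _), ← div_div, div_eq_mul_inv _ ((y : ℂ) - _), h2] at h1
  have hI := Complex.I_ne_zero
  rcases eq_or_ne w 0 with rfl | hw
  · simp
  rw [uFun_add] at h1 ⊢
  field_simp at h1 ⊢
  linear_combination h1

theorem uFun_div_sqrt (k : ℤ) (y : ℝ) :
    uFun (k + 2) y / (√(1 + y ^ 2) : ℝ) - uFun k y / (√(1 + y ^ 2) : ℝ)
      = 2 * Complex.I * (uFun (k + 1) y / (1 + (y : ℂ) ^ 2)) := by
  have h := uFun_one_sub_uFun_neg_one y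
  have hs := sqrt_one_add_sq_ne_zero y
  rw [show k + 2 = k + 1 + 1 by ring, uFun_add (k + 1) 1, show k = k + 1 + -1 by ring,
    uFun_add (k + 1) (-1), show k + 1 + -1 + 1 = k + 1 by ring, ← sub_div, ← mul_sub, h,
    ← ofReal_sqrt_one_add_sq_sq]
  field_simp

/-- The principal value for the kernel `1 / (√(1 + y²) (x - y))` is exactly the boundary term. -/
theorem hasPV_uFun_div_sqrt (x : ℝ) (n : ℕ) :
    HasPV x (fun y => uFun (-(2 * n + 1)) y / ((√(1 + y ^ 2) : ℝ) * (x - y)))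
      (-(Complex.I * Real.pi * uFun (-(2 * n + 1)) x / (√(1 + x ^ 2) : ℝ))) := by
  induction n with
  | zero =>
    have h := hasPV_inv_add_I_mul_sub x
    have hs := sqrt_one_add_sq_ne_zero
    simp only [Nat.cast_zero, mul_zero, zero_add, uFun_neg_one]
    convert h.congr (fun y hy => ?_) using 1
    · have := hs x
      have := ofReal_add_I_ne_zero x
      field_simp
    · have := hs y
      have := ofReal_add_I_ne_zero y
      have : (x : ℂ) - y ≠ 0 := by exact_mod_cast sub_ne_zero.2 hy.symm
      field_simp
  | succ n ih =>
    set k : ℤ := -(2 * ((n + 1 : ℕ) : ℤ) + 1) with hk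
    have hk2 : -(2 * (n : ℤ) + 1) = k + 2 := by
      push_cast [hk]
      ring
    have hodd : Even (k + 1) := ⟨-(n + 1 : ℤ), by push_cast [hk]; ring⟩
    have hk1 : k + 1 ≠ 0 := by
      push_cast [hk]
      omega
    rw [hk2] at ih
    have h0 := (HasPV.of_integrable x (integrable_uFun_div (k + 1))).const_mul
      (-(uFun (-2) x * (1 / (x - Complex.I) * (2 * Complex.I))))
    rw [integral_uFun_div hk1, hodd.neg_one_zpow, sub_self, mul_zero, mul_zero] at h0
    have hinv : uFun (-2) x * uFun 2 x = 1 := by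
      rw [← uFun_add, neg_add_cancel, uFun_zero]
    convert ((ih.const_mul (uFun (-2) x)).add h0).congr (fun y hy => ?_) using 1
    · rw [uFun_add k 2 x]
      linear_combination (Complex.I * Real.pi * uFun k x / (√(1 + x ^ 2) : ℝ)) * hinv
    · rw [uFun_div_sub_succ k hy, uFun_div_sqrt]
      linear_combination (uFun k y / ((√(1 + y ^ 2) : ℝ) * (x - y))) * hinv

/-- The regular part of the kernel `1 / ((1 + y²) (x - y))` after its singularity is removed. -/
noncomputable def regularKernel (x y : ℝ) : ℝ :=
  (x + y) / ((1 + y ^ 2) * √(1 + x ^ 2) * (√(1 + y ^ 2) + √(1 + x ^ 2)))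

theorem integrable_uFun_mul_regularKernel (k : ℤ) (x : ℝ) :
    Integrable fun y => uFun k y * (regularKernel x y : ℂ) := by
  have hle : ∀ y : ℝ, |y| ≤ √(1 + y ^ 2) := fun y => Real.abs_le_sqrt (by linarith)
  have hone : ∀ y : ℝ, 1 ≤ √(1 + y ^ 2) := fun y => Real.one_le_sqrt.2 (by nlinarith [sq_nonneg y])
  suffices h : Integrable (regularKernel x) from
    Integrable.bdd_mul (c := 1) h.ofReal (continuous_uFun k).aestronglyMeasurable
      (.of_forall fun y => (norm_uFun k y).le)
  refine integrable_inv_one_add_sq.mono' ?_ (.of_forall fun y => ?_)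
  · unfold regularKernel
    exact Measurable.aestronglyMeasurable (by fun_prop)
  · have hx := hone x
    have hy := hone y
    rw [regularKernel, Real.norm_eq_abs, abs_div, abs_of_pos (a := _ * _) (by positivity),
      div_le_iff₀ (by positivity), ← mul_assoc, ← mul_assoc, inv_mul_cancel₀ (by positivity),
      one_mul]
    nlinarith [abs_add_le x y, hle x, hle y]

theorem uFun_kernel_eq (k : ℤ) {x y : ℝ} (hy : y ≠ x) :
    uFun k y / ((1 + (y : ℂ) ^ 2) * (x - y))
      = 1 / (√(1 + x ^ 2) : ℝ) * (uFun k y / ((√(1 + y ^ 2) : ℝ) * (x - y)))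
        + uFun k y * (regularKernel x y : ℂ) := by
  have hx : 0 < √(1 + x ^ 2) := Real.sqrt_pos.2 (by positivity)
  have hy' : 0 < √(1 + y ^ 2) := Real.sqrt_pos.2 (by positivity)
  have hx2 := Real.sq_sqrt (show 0 ≤ 1 + x ^ 2 by positivity)
  have hy2 := Real.sq_sqrt (show 0 ≤ 1 + y ^ 2 by positivity)
  have hxy : x - y ≠ 0 := sub_ne_zero.2 hy.symm
  have key : 1 / ((1 + y ^ 2) * (x - y))
      = 1 / √(1 + x ^ 2) * (1 / (√(1 + y ^ 2) * (x - y))) + regularKernel x y := by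
    rw [regularKernel]
    generalize √(1 + y ^ 2) = b at *
    generalize √(1 + x ^ 2) = a at *
    rw [← hy2]
    have : b + a ≠ 0 := by positivity
    field_simp
    linear_combination hx2 - hy2
  have key' := congrArg (fun r : ℝ => (r : ℂ)) key
  push_cast at key'
  rw [div_eq_mul_one_div, key']
  ring

theorem hasPV_uFun_kernel (x : ℝ) (n : ℕ) :
    HasPV x (fun y => uFun (-(2 * n + 1)) y / ((1 + (y : ℂ) ^ 2) * (x - y)))
      (-(Complex.I * Real.pi * uFun (-(2 * n + 1)) x / (1 + (x : ℂ) ^ 2))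
        + ∫ y, uFun (-(2 * n + 1)) y * (regularKernel x y : ℂ)) := by
  convert (((hasPV_uFun_div_sqrt x n).const_mul (1 / (√(1 + x ^ 2) : ℝ))).add
    (.of_integrable x (integrable_uFun_mul_regularKernel (-(2 * n + 1)) x))).congr
    (fun y hy => (uFun_kernel_eq _ hy).symm) using 2
  have := sqrt_one_add_sq_ne_zero x
  rw [← ofReal_sqrt_one_add_sq_sq]
  field_simp

theorem hasPV_uFun_kernel_add_two {k : ℤ} (hk : Odd k) {x : ℝ} {L : ℂ}
    (h : HasPV x (fun y => uFun k y / ((1 + (y : ℂ) ^ 2) * (x - y))) L) :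
    HasPV x (fun y => uFun (k + 2) y / ((1 + (y : ℂ) ^ 2) * (x - y)))
      (uFun 2 x * L - 4 * Complex.I / (x - Complex.I) / (k * (k + 2))) := by
  have hk0 : k ≠ 0 := by rintro rfl; simp at hk
  have hk2 : Odd (k + 2) := hk.add_even even_two
  have hk20 : k + 2 ≠ 0 := fun h0 => by simp [h0] at hk2
  have h1 : (k : ℂ) ≠ 0 := by exact_mod_cast hk0
  have h2 : (k : ℂ) + 2 ≠ 0 := by exact_mod_cast hk20
  have h3 := ofReal_sub_I_ne_zero x
  have hI := HasPV.of_integrable x ((integrable_uFun_div (k + 2)).sub (integrable_uFun_div k))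
  simp only [Pi.sub_apply] at hI
  rw [integral_sub (integrable_uFun_div (k + 2)) (integrable_uFun_div k),
    integral_uFun_div hk0, integral_uFun_div hk20, hk.neg_one_zpow, hk2.neg_one_zpow] at hI
  convert ((h.const_mul (uFun 2 x)).add (hI.const_mul (1 / (x - Complex.I)))).congr
    (fun y hy => (uFun_div_sub_succ k hy _).symm) using 1
  push_cast
  field_simp
  ring

/-- The Riemann–Lebesgue lemma for the family `u_k`. -/
theorem tendsto_integral_uFun_mul_cofinite (f : ℝ → ℂ) :
    Tendsto (fun k : ℤ => ∫ y, uFun k y * f y) cofinite (nhds 0) := by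
  set S : Set ℝ := Set.Ioo (-(Real.pi / 2)) (Real.pi / 2) with hS
  set g : ℝ → ℂ := S.indicator fun s => |1 / Real.cos s ^ 2| • f (Real.tan s) with hg
  have hpi := Real.pi_ne_zero
  have hw : Tendsto (fun k : ℤ => (k : ℝ) / (2 * Real.pi)) cofinite (cocompact ℝ) :=
    (Homeomorph.mulRight₀ ((2 * Real.pi)⁻¹) (by positivity)).isClosedEmbedding.tendsto_cocompact.comp
      Int.tendsto_coe_cofinite
  have h := ((Real.tendsto_integral_exp_smul_cocompact g).comp hw).norm
  rw [norm_zero] at h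
  rw [tendsto_zero_iff_norm_tendsto_zero]
  refine h.congr fun k => ?_
  have hcv : ∫ y, uFun k y * f y
      = ∫ s in S, |1 / Real.cos s ^ 2| • (uFun k (Real.tan s) * f (Real.tan s)) := by
    rw [← integral_image_eq_integral_abs_deriv_smul measurableSet_Ioo
      (fun s hs => (Real.hasDerivAt_tan_of_mem_Ioo hs).hasDerivWithinAt) Real.injOn_tan
      fun y => uFun k y * f y, Real.image_tan_Ioo, setIntegral_univ]
  have hfac : ∫ y, uFun k y * f y = Complex.exp (((k * (Real.pi / 2) : ℝ) : ℂ) * Complex.I) *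
      ∫ s, Real.fourierChar (-(s * ((k : ℝ) / (2 * Real.pi)))) • g s := by
    rw [hcv, ← integral_const_mul, ← integral_indicator measurableSet_Ioo]
    congr 1
    ext s
    by_cases hs : s ∈ S
    · rw [hg, Set.indicator_of_mem hs, Set.indicator_of_mem hs, Circle.smul_def,
        Real.fourierChar_apply, smul_eq_mul, ← mul_assoc, ← Complex.exp_add, uFun_eq_exp,
        Real.arctan_tan hs.1 hs.2, Complex.real_smul, Complex.real_smul, mul_left_comm]
      congr 2
      push_cast
      have : (Real.pi : ℂ) ≠ 0 := by exact_mod_cast hpi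
      field_simp
      ring
    · rw [hg, Set.indicator_of_notMem hs, Set.indicator_of_notMem hs, smul_zero, mul_zero]
  rw [hfac, norm_mul, Complex.norm_exp_ofReal_mul_I, one_mul]
  rfl

/-- An induction principle for odd integers, starting from all those that are at most `-3`. -/
theorem Int.odd_induction_add_two {P : ℤ → Prop} (hneg : ∀ n : ℕ, P (-(2 * ((n + 1 : ℕ) : ℤ) + 1)))
    (hstep : ∀ k, Odd k → P k → P (k + 2)) {k : ℤ} (hk : Odd k) : P k := by
  have hpos : ∀ n : ℕ, P (-3 + 2 * n) := fun n => by
    induction n with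
    | zero => simpa using hneg 0
    | succ n ih =>
      have := hstep _ (Odd.add_even (by decide) (even_two_mul _)) ih
      rwa [add_assoc, ← mul_add_one, ← Nat.cast_succ] at this
  obtain ⟨m, rfl⟩ := hk
  rcases le_total m (-2) with h | h
  · obtain ⟨n, hn⟩ := Int.eq_ofNat_of_zero_le (show 0 ≤ -2 - m by omega)
    convert hneg n using 1
    push_cast
    omega
  · obtain ⟨n, hn⟩ := Int.eq_ofNat_of_zero_le (show 0 ≤ m + 2 by omega)
    convert hpos n using 1
    omega

theorem neg_intCast_div_two_add_ne_zero {k : ℤ} (hk : Odd k) (m : ℤ) : -(k : ℂ) / 2 + m ≠ 0 := by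
  intro h
  have h2 : (k : ℂ) = ((2 * m : ℤ) : ℂ) := by
    push_cast
    linear_combination -2 * h
  exact Int.not_even_iff_odd.2 hk (Int.cast_injective h2 ▸ even_two_mul m)

/-- The terms `zⁿ / ((b + n) (b + n + 1) (b + n + 2))` with `b = -k/2 - 1`. -/
noncomputable def hypTerm (k : ℤ) (z : ℂ) (n : ℕ) : ℂ :=
  z ^ n / ((-(k : ℂ) / 2 - 1 + n) * (-(k : ℂ) / 2 + n) * (-(k : ℂ) / 2 + 1 + n))

theorem hypTerm_add_two (k : ℤ) (z : ℂ) (n : ℕ) :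
    hypTerm (k + 2) z (n + 1) = z * hypTerm k z n := by
  unfold hypTerm
  push_cast
  rw [pow_succ', mul_div_assoc]
  ring_nf

theorem norm_hypTerm_le {z : ℂ} (hz : ‖z‖ = 1) (m n : ℕ) :
    ‖hypTerm (-(2 * ((m + 1 : ℕ) : ℤ) + 1)) z n‖
      ≤ 1 / ((m : ℝ) + 1 / 2) * (1 / ((n : ℝ) + 1) ^ 2) := by
  have hden : (-((-(2 * ((m + 1 : ℕ) : ℤ) + 1) : ℤ) : ℂ) / 2 - 1 + n)
      * (-((-(2 * ((m + 1 : ℕ) : ℤ) + 1) : ℤ) : ℂ) / 2 + n)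
      * (-((-(2 * ((m + 1 : ℕ) : ℤ) + 1) : ℤ) : ℂ) / 2 + 1 + n)
      = (((m + 1 / 2 + n) * (m + 3 / 2 + n) * (m + 5 / 2 + n) : ℝ) : ℂ) := by
    push_cast
    ring
  rw [hypTerm, hden, norm_div, norm_pow, hz, one_pow, Complex.norm_real,
    Real.norm_of_nonneg (by positivity), one_div_mul_one_div]
  refine one_div_le_one_div_of_le (by positivity) ?_
  have hm : (0 : ℝ) ≤ m := m.cast_nonneg
  have hn : (0 : ℝ) ≤ n := n.cast_nonneg
  nlinarith [mul_nonneg hm hn, mul_nonneg (mul_nonneg hm hn) hn, mul_nonneg (mul_nonneg hm hm) hn,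
    mul_nonneg (mul_nonneg hm hm) hm]

theorem summable_one_div_nat_add_one_sq : Summable fun n : ℕ => 1 / ((n : ℝ) + 1) ^ 2 := by
  simpa using (summable_nat_add_iff 1).2 (Real.summable_one_div_nat_pow.2 one_lt_two)

theorem summable_hypTerm {k : ℤ} (hk : Odd k) {z : ℂ} (hz : ‖z‖ = 1) : Summable (hypTerm k z) := by
  refine Int.odd_induction_add_two (P := fun k => Summable (hypTerm k z)) (fun m => ?_)
    (fun k _ h => ?_) hk
  · exact .of_norm_bounded (summable_one_div_nat_add_one_sq.mul_left _) (norm_hypTerm_le hz m)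
  · rw [← summable_nat_add_iff 1]
    simpa only [hypTerm_add_two] using h.mul_left z

/-- The principal value for `u_k(y) / ((1 + y²) (x - y))` minus its local boundary term. -/
noncomputable def hypPart (k : ℤ) (z : ℂ) : ℂ :=
  2 / (k * (k + 2)) - ∑' n, hypTerm k z n

theorem hypPart_add_two {k : ℤ} (hk : Odd k) {z : ℂ} (hz : ‖z‖ = 1) :
    hypPart (k + 2) z = z * hypPart k z + 2 * (1 - z) / (k * (k + 2)) := by
  have hk2 : Odd (k + 2) := hk.add_even even_two
  have h0 : (k : ℂ) ≠ 0 := fun h => neg_intCast_div_two_add_ne_zero hk 0 (by simp [h])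
  have h2 : (k : ℂ) + 2 ≠ 0 := fun h => neg_intCast_div_two_add_ne_zero hk (-1) <| by
    push_cast
    linear_combination -h / 2
  have h4 : (k : ℂ) + 4 ≠ 0 := fun h => neg_intCast_div_two_add_ne_zero hk (-2) <| by
    push_cast
    linear_combination -h / 2
  have hfirst : hypTerm (k + 2) z 0 = -8 / (k * (k + 2) * (k + 4)) := by
    have : (-((k + 2 : ℤ) : ℂ) / 2 - 1 + (0 : ℕ)) * (-((k + 2 : ℤ) : ℂ) / 2 + (0 : ℕ))
        * (-((k + 2 : ℤ) : ℂ) / 2 + 1 + (0 : ℕ)) = -(k * (k + 2) * (k + 4)) / 8 := by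
      push_cast
      ring
    rw [hypTerm, this, pow_zero]
    field_simp
  rw [hypPart, hypPart, (summable_hypTerm hk2 hz).tsum_eq_zero_add, hfirst]
  simp only [hypTerm_add_two, tsum_mul_left]
  push_cast
  rw [show (k : ℂ) + 2 + 2 = k + 4 by ring]
  field_simp
  ring

theorem tendsto_hypPart {z : ℂ} (hz : ‖z‖ = 1) :
    Tendsto (fun m : ℕ => hypPart (-(2 * ((m + 1 : ℕ) : ℤ) + 1)) z) atTop (nhds 0) := by
  have hinv : Tendsto (fun m : ℕ => 1 / ((m : ℝ) + 1 / 2)) atTop (nhds 0) :=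
    tendsto_const_nhds.div_atTop (tendsto_atTop_add_const_right _ _ tendsto_natCast_atTop_atTop)
  have hsum : Tendsto (fun m : ℕ => ∑' n, hypTerm (-(2 * ((m + 1 : ℕ) : ℤ) + 1)) z n) atTop
      (nhds 0) := by
    refine squeeze_zero_norm (fun m => tsum_of_norm_bounded
      (summable_one_div_nat_add_one_sq.mul_left _).hasSum (norm_hypTerm_le hz m)) ?_
    simpa only [tsum_mul_left, zero_mul] using hinv.mul_const (∑' n : ℕ, 1 / ((n : ℝ) + 1) ^ 2)
  have hfrac : Tendsto (fun m : ℕ => (2 : ℂ) / (((-(2 * ((m + 1 : ℕ) : ℤ) + 1) : ℤ) : ℂ)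
      * (((-(2 * ((m + 1 : ℕ) : ℤ) + 1) : ℤ) : ℂ) + 2))) atTop (nhds 0) := by
    refine squeeze_zero_norm (fun m => ?_) hinv
    rw [show ((-(2 * ((m + 1 : ℕ) : ℤ) + 1) : ℤ) : ℂ) * (((-(2 * ((m + 1 : ℕ) : ℤ) + 1) : ℤ) : ℂ)
      + 2) = (((2 * m + 3) * (2 * m + 1) : ℝ) : ℂ) by push_cast; ring, norm_div, Complex.norm_real,
      Complex.norm_two, Real.norm_of_nonneg (by positivity),
      div_le_div_iff₀ (by positivity) (by positivity)]
    nlinarith [m.cast_nonneg (α := ℝ)]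
  simpa [hypPart] using hfrac.sub hsum

theorem one_sub_uFun_two (x : ℝ) : 1 - uFun 2 x = -2 * Complex.I / (x - Complex.I) := by
  have := ofReal_sub_I_ne_zero x
  rw [uFun_two]
  field_simp
  ring

theorem integral_uFun_mul_regularKernel (x : ℝ) (m : ℕ) :
    ∫ y, uFun (-(2 * ((m + 1 : ℕ) : ℤ) + 1)) y * (regularKernel x y : ℂ)
      = hypPart (-(2 * ((m + 1 : ℕ) : ℤ) + 1)) (uFun 2 x) := by
  set κ : ℕ → ℤ := fun m => -(2 * ((m + 1 : ℕ) : ℤ) + 1) with hκ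
  have hκs : ∀ m, κ (m + 1) + 2 = κ m := fun m => by
    simp only [hκ]
    push_cast
    ring
  have hodd : ∀ m, Odd (κ m) := fun m => (odd_two_mul_add_one _).neg
  have hinj : Function.Injective κ := fun a b h => by
    simp only [hκ] at h
    omega
  set R : ℕ → ℂ := fun m => ∫ y, uFun (κ m) y * (regularKernel x y : ℂ) with hR
  set D : ℕ → ℂ := fun m => R m - hypPart (κ m) (uFun 2 x) with hD
  have hstep : ∀ m, D m = uFun 2 x * D (m + 1) := by
    intro m
    have h1 := (hasPV_uFun_kernel_add_two (hodd (m + 1)) (hasPV_uFun_kernel x (m + 2)))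
    have h2 := hypPart_add_two (hodd (m + 1)) (norm_uFun 2 x)
    rw [hκs] at h1 h2
    have h3 := h1.unique (hasPV_uFun_kernel x (m + 1))
    have h4 : uFun (κ m) x = uFun 2 x * uFun (κ (m + 1)) x := by
      rw [← hκs, uFun_add, mul_comm]
    change uFun 2 x * (-(Complex.I * Real.pi * uFun (κ (m + 1)) x / (1 + (x : ℂ) ^ 2)) + R (m + 1))
      - 4 * Complex.I / (x - Complex.I) / (κ (m + 1) * (κ (m + 1) + 2))
      = -(Complex.I * Real.pi * uFun (κ m) x / (1 + (x : ℂ) ^ 2)) + R m at h3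
    rw [one_sub_uFun_two] at h2
    simp only [hD]
    rw [h2]
    rw [h4] at h3
    linear_combination -h3
  have hnorm : ∀ m, ‖D m‖ = ‖D 0‖ := fun m => by
    induction m with
    | zero => rfl
    | succ m ih => rw [← ih, hstep m, norm_mul, norm_uFun, one_mul]
  have hlim : Tendsto D atTop (nhds 0) := by
    have h := (tendsto_integral_uFun_mul_cofinite fun y => (regularKernel x y : ℂ)).comp
      hinj.tendsto_cofinite
    rw [Nat.cofinite_eq_atTop] at h
    have h' := h.sub (tendsto_hypPart (norm_uFun 2 x))
    rwa [sub_zero] at h'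
  have hzero : ‖D m‖ = 0 := by
    rw [hnorm m]
    refine tendsto_nhds_unique ?_ (by simpa using hlim.norm)
    simp only [hnorm, tendsto_const_nhds]
  exact sub_eq_zero.1 (norm_eq_zero.1 hzero)

theorem hasPV_uFun_kernel_of_odd {k : ℤ} (hk : Odd k) (x : ℝ) :
    HasPV x (fun y => uFun k y / ((1 + (y : ℂ) ^ 2) * (x - y)))
      (-(Complex.I * Real.pi * uFun k x / (1 + (x : ℂ) ^ 2)) + hypPart k (uFun 2 x)) := by
  refine Int.odd_induction_add_two (P := fun k =>
    HasPV x (fun y => uFun k y / ((1 + (y : ℂ) ^ 2) * (x - y)))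
      (-(Complex.I * Real.pi * uFun k x / (1 + (x : ℂ) ^ 2)) + hypPart k (uFun 2 x)))
    (fun m => ?_) (fun k hk h => ?_) hk
  · rw [← integral_uFun_mul_regularKernel]
    exact hasPV_uFun_kernel x (m + 1)
  · convert hasPV_uFun_kernel_add_two hk h using 1
    rw [hypPart_add_two hk (norm_uFun 2 x), one_sub_uFun_two, uFun_add]
    ring

theorem ascPochhammer_eval_add_three {b : ℂ} (hb : ∀ n : ℕ, b + n ≠ 0) (n : ℕ) :
    (ascPochhammer ℂ n).eval b / (ascPochhammer ℂ n).eval (b + 3)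
      = b * (b + 1) * (b + 2) / ((b + n) * (b + 1 + n) * (b + 2 + n)) := by
  have h1 : ∀ n : ℕ, b + 1 + n ≠ 0 := fun n => by
    have := hb (n + 1)
    push_cast at this
    rwa [add_assoc, add_comm (1 : ℂ)]
  have h2 : ∀ n : ℕ, b + 2 + n ≠ 0 := fun n => by
    have := hb (n + 2)
    push_cast at this
    rwa [add_assoc, add_comm (2 : ℂ)]
  have h3 : ∀ n : ℕ, b + 3 + n ≠ 0 := fun n => by
    have := hb (n + 3)
    push_cast at this
    rwa [add_assoc, add_comm (3 : ℂ)]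
  induction n with
  | zero =>
    have := hb 0
    have := h1 0
    have := h2 0
    simp_all
  | succ n ih =>
    rw [ascPochhammer_succ_eval, ascPochhammer_succ_eval, ← div_mul_div_comm, ih]
    have e0 := hb n
    have e1 := h1 n
    have e2 := h2 n
    have e3 := h3 n
    push_cast
    rw [show b + (n + 1 : ℂ) = b + 1 + n by ring, show b + 1 + (n + 1 : ℂ) = b + 2 + n by ring,
      show b + 2 + (n + 1 : ℂ) = b + 3 + n by ring]
    field_simp

theorem hypergeometric_term_eq {k : ℤ} (hk : Odd k) (z : ℂ) (n : ℕ) :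
    (ascPochhammer ℂ n).eval 1 * (ascPochhammer ℂ n).eval (-(k : ℂ) / 2 - 1)
        / ((ascPochhammer ℂ n).eval (-(k : ℂ) / 2 + 2) * (n.factorial : ℂ)) * z ^ n
      = k * (4 - (k : ℂ) ^ 2) / 8 * hypTerm k z n := by
  have h := ascPochhammer_eval_add_three (b := -(k : ℂ) / 2 - 1) (fun n => by
    have := neg_intCast_div_two_add_ne_zero hk (n - 1)
    push_cast at this
    rwa [sub_add_eq_add_sub, ← add_sub_assoc] at *) n
  rw [show -(k : ℂ) / 2 - 1 + 3 = -(k : ℂ) / 2 + 2 by ring,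
    show -(k : ℂ) / 2 - 1 + 1 = -(k : ℂ) / 2 by ring,
    show -(k : ℂ) / 2 - 1 + 2 = -(k : ℂ) / 2 + 1 by ring] at h
  have hn : (n.factorial : ℂ) ≠ 0 := Nat.cast_ne_zero.2 n.factorial_ne_zero
  rw [ascPochhammer_eval_one, mul_comm (n.factorial : ℂ), mul_div_mul_right _ _ hn, h, hypTerm]
  ring

/-- For `k` odd, `x ∈ ℝ` and `z = (x+i)²/(x²+1)`, the principal value
`(1/π)·PV∫ u_k'(y)/(x−y) dy` exists and equals
`−2i/(π(k+2)) − k(x+i)^k/(x²+1)^{k/2+1} + (8i/(π(4−k²)))·₂F₁(1, −k/2−1; −k/2+2; z)`. -/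
theorem halfLaplacian_uFun_odd_2F1 (k : ℤ) (hk : Odd k) (x : ℝ) (z : ℂ)
    (hz : z = ((x : ℂ) + Complex.I) ^ 2 / ((x : ℂ) ^ 2 + 1)) :
    Tendsto (fun ε : ℝ => (1 / (Real.pi : ℂ)) *
        ∫ y in {y : ℝ | ε ≤ |x - y|}, deriv (uFun k) y / ((x : ℂ) - (y : ℂ)))
      (nhdsWithin 0 (Set.Ioi 0))
      (nhds (
        -2 * Complex.I / ((Real.pi : ℂ) * ((k : ℂ) + 2))
        - (k : ℂ) * ((x : ℂ) + Complex.I) ^ k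
            / ((((x ^ 2 + 1 : ℝ) ^ ((k : ℝ) / 2 + 1) : ℝ)) : ℂ)
        + (8 * Complex.I / ((Real.pi : ℂ) * (4 - (k : ℂ) ^ 2))) *
            ∑' n : ℕ, (ascPochhammer ℂ n).eval 1
              * (ascPochhammer ℂ n).eval (-(k : ℂ) / 2 - 1)
              / ((ascPochhammer ℂ n).eval (-(k : ℂ) / 2 + 2) * (n.factorial : ℂ))
              * z ^ n)) := by
  obtain rfl : z = uFun 2 x := by
    rw [hz, uFun_two, add_comm ((x : ℂ) ^ 2), ← add_I_mul_sub_I, sq,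
      mul_div_mul_left _ _ (ofReal_add_I_ne_zero x)]
  have hk0 : (k : ℂ) ≠ 0 := fun h => neg_intCast_div_two_add_ne_zero hk 0 (by simp [h])
  have hk2 : (k : ℂ) + 2 ≠ 0 := fun h => neg_intCast_div_two_add_ne_zero hk (-1) <| by
    push_cast
    linear_combination -h / 2
  have hk2' : 2 - (k : ℂ) ≠ 0 := fun h => neg_intCast_div_two_add_ne_zero hk 1 <| by
    push_cast
    linear_combination h / 2
  have hk4 : 4 - (k : ℂ) ^ 2 ≠ 0 := by
    rw [show 4 - (k : ℂ) ^ 2 = (2 - k) * (k + 2) by ring]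
    exact mul_ne_zero hk2' hk2
  have hpi : (Real.pi : ℂ) ≠ 0 := by exact_mod_cast Real.pi_ne_zero
  have hlocal : ((x : ℂ) + Complex.I) ^ k / ((((x ^ 2 + 1 : ℝ) ^ ((k : ℝ) / 2 + 1) : ℝ)) : ℂ)
      = uFun k x / (1 + (x : ℂ) ^ 2) := by
    rw [Real.rpow_add (by positivity), Real.rpow_one, Complex.ofReal_mul, ← div_div, uFun]
    push_cast
    rw [add_comm (1 : ℂ)]
  have h := ((hasPV_uFun_kernel_of_odd hk x).const_mul (-(Complex.I * k))).congr
    (g := fun y => deriv (uFun k) y / (x - y)) fun y _ => by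
      rw [(hasDerivAt_uFun k y).deriv, ← div_div]
      ring
  have hlim := h.2.const_mul (1 / (Real.pi : ℂ))
  convert hlim using 2
  simp only [hypergeometric_term_eq hk, tsum_mul_left]
  rw [mul_div_assoc (k : ℂ), hlocal, hypPart]
  have hx := one_add_ofReal_sq_ne_zero x
  field_simp
  ring_nf
  simp only [Complex.I_sq]
  ring
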